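/- arXiv:1212.4681 — 3 statements merged into one kernel-verified Lean document; each statement's English description precedes it below -/
import Mathlib

section
/- Let p, q ∈ (1, ∞) and let p₂ > 0. For all x, y ∈ (0, ∞), one has arcsinh_{p,q}(H_{p₂}(x, y)) ≥ √(arcsinh_{p,q}(x) · arcsinh_{p,q}(y)), where H_{p₂}(x, y) = ((x^{p₂} + y^{p₂})/2)^{1/p₂}. -/
open MeasureTheory Set

lemma continuousOn_one_add_rpow_rpow {q : ℝ} (hq : 0 ≤ q) (r : ℝ) :
    ContinuousOn (fun t : ℝ => (1 + t ^ q) ^ r) (Ici 0) := by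
  refine ContinuousOn.rpow_const ?_ fun t ht => Or.inl ?_
  · exact continuousOn_const.add (continuousOn_id.rpow_const fun t _ => Or.inr hq)
  · have := Real.rpow_nonneg (mem_Ici.mp ht) q
    positivity

lemma intervalIntegrable_of_continuousOn_Ici {f : ℝ → ℝ} (hf : ContinuousOn f (Ici 0))
    {a b : ℝ} (ha : 0 ≤ a) (hb : 0 ≤ b) : IntervalIntegrable f volume a b :=
  (hf.mono fun _ ht => (le_min ha hb).trans ht.1).intervalIntegrable

/-- For `k ≥ 1` and `r ≤ 0` the quotient `f (k t) / f t` of `f t = (1 + t ^ q) ^ r` is antitone. -/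
lemma one_add_rpow_rpow_cross_le {q r k s t : ℝ} (hq : 0 ≤ q) (hr : r ≤ 0) (hk : 1 ≤ k)
    (ht : 0 ≤ t) (hts : t ≤ s) :
    (1 + (k * s) ^ q) ^ r * (1 + t ^ q) ^ r ≤ (1 + (k * t) ^ q) ^ r * (1 + s ^ q) ^ r := by
  have hs : 0 ≤ s := ht.trans hts
  have hk0 : 0 ≤ k := zero_le_one.trans hk
  have hkq : 1 ≤ k ^ q := Real.one_le_rpow hk hq
  have hsq : t ^ q ≤ s ^ q := Real.rpow_le_rpow ht hts hq
  rw [← Real.mul_rpow (by positivity) (by positivity),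
    ← Real.mul_rpow (by positivity) (by positivity)]
  refine Real.rpow_le_rpow_of_nonpos (by positivity) ?_ hr
  rw [Real.mul_rpow hk0 hs, Real.mul_rpow hk0 ht]
  nlinarith [mul_nonneg (sub_nonneg.2 hkq) (sub_nonneg.2 hsq)]

/-- If `f (k t) / f t` is antitone on `[0, ∞)`, the primitive of `f` is log-concave along the
geometric progression `x, k x, k² x`. -/
lemma integral_mul_integral_le_sq {f : ℝ → ℝ} (hf : ContinuousOn f (Ici 0))
    (hpos : ∀ t, 0 ≤ t → 0 < f t) {k x : ℝ} (hk : 1 ≤ k) (hx : 0 ≤ x)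
    (hcross : ∀ t s, 0 ≤ t → t ≤ s → f (k * s) * f t ≤ f (k * t) * f s) :
    (∫ t in (0:ℝ)..x, f t) * (∫ t in (0:ℝ)..(k * (k * x)), f t) ≤
      (∫ t in (0:ℝ)..(k * x), f t) ^ 2 := by
  have hk0 : 0 < k := zero_lt_one.trans_le hk
  have hkx : x ≤ k * x := le_mul_of_one_le_left hx hk
  have hkx0 : 0 ≤ k * x := hx.trans hkx
  have hfk : ContinuousOn (fun t => k * f (k * t)) (Ici 0) :=
    continuousOn_const.mul (hf.comp (by fun_prop) fun t ht => mul_nonneg hk0.le ht)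
  have hsub (a b : ℝ) : ∫ t in a..b, k * f (k * t) = ∫ t in (k * a)..(k * b), f t := by
    rw [intervalIntegral.integral_const_mul, intervalIntegral.mul_integral_comp_mul_left]
  have hsplit {a b : ℝ} (ha : 0 ≤ a) (hb : 0 ≤ b) :
      (∫ t in (0:ℝ)..a, f t) + ∫ t in a..b, f t = ∫ t in (0:ℝ)..b, f t :=
    intervalIntegral.integral_add_adjacent_intervals
      (intervalIntegrable_of_continuousOn_Ici hf le_rfl ha)
      (intervalIntegrable_of_continuousOn_Ici hf ha hb)
  have hfx := hpos x hx
  set c := k * f (k * x) / f x with hc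
  have hlower : c * ∫ t in (0:ℝ)..x, f t ≤ ∫ t in (0:ℝ)..(k * x), f t := by
    have h := hsub 0 x
    rw [mul_zero] at h
    rw [← h, ← intervalIntegral.integral_const_mul]
    refine intervalIntegral.integral_mono_on hx
      ((intervalIntegrable_of_continuousOn_Ici hf le_rfl hx).const_mul c)
      (intervalIntegrable_of_continuousOn_Ici hfk le_rfl hx) fun t ht => ?_
    rw [hc, div_mul_eq_mul_div, div_le_iff₀ hfx, mul_assoc, mul_assoc]
    exact mul_le_mul_of_nonneg_left (hcross t x ht.1 ht.2) hk0.le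
  have hupper : ∫ t in (k * x)..(k * (k * x)), f t ≤ c * ∫ t in x..(k * x), f t := by
    rw [← hsub, ← intervalIntegral.integral_const_mul]
    refine intervalIntegral.integral_mono_on hkx
      (intervalIntegrable_of_continuousOn_Ici hfk hx hkx0)
      ((intervalIntegrable_of_continuousOn_Ici hf hx hkx0).const_mul c) fun t ht => ?_
    rw [hc, div_mul_eq_mul_div, le_div_iff₀ hfx, mul_assoc, mul_assoc]
    exact mul_le_mul_of_nonneg_left (hcross x t hx ht.1) hk0.le
  have hA : 0 ≤ ∫ t in (0:ℝ)..x, f t :=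
    intervalIntegral.integral_nonneg hx fun t ht => (hpos t ht.1).le
  have hB : 0 ≤ ∫ t in x..(k * x), f t :=
    intervalIntegral.integral_nonneg hkx fun t ht => (hpos t (hx.trans ht.1)).le
  have h1 := hsplit hx hkx0
  have h2 := hsplit hkx0 (mul_nonneg hk0.le hkx0)
  nlinarith [mul_le_mul_of_nonneg_left hupper hA, mul_le_mul_of_nonneg_right hlower hB]

/-- The geometric mean is at most the Hölder mean of positive order. -/
lemma sqrt_mul_le_holder_mean {r x y : ℝ} (hr : 0 < r) (hx : 0 ≤ x) (hy : 0 ≤ y) :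
    √(x * y) ≤ ((x ^ r + y ^ r) / 2) ^ (1 / r) := by
  have hxr := Real.rpow_nonneg hx r
  have hyr := Real.rpow_nonneg hy r
  rw [one_div, Real.le_rpow_inv_iff_of_pos (Real.sqrt_nonneg _) (by positivity) hr]
  refine (sq_le_sq₀ (by positivity) (by positivity)).1 ?_
  rw [sq (√(x * y) ^ r), ← Real.mul_rpow (Real.sqrt_nonneg _) (Real.sqrt_nonneg _),
    Real.mul_self_sqrt (mul_nonneg hx hy), Real.mul_rpow hx hy]
  nlinarith [sq_nonneg (x ^ r - y ^ r)]

/-- Inequality (2.21): for `p, q ∈ (1, ∞)`, `p₂ > 0` and `x, y ∈ (0, ∞)`,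
`arcsinh_{p,q}(H_{p₂}(x, y)) ≥ √(arcsinh_{p,q}(x) · arcsinh_{p,q}(y))`,
where `H_{p₂}(x, y) = ((x^{p₂} + y^{p₂})/2)^{1/p₂}` is the Hölder mean. -/
theorem arcsinh_pq_holder_mean (p q : ℝ) (hp : 1 < p) (hq : 1 < q)
    (p₂ : ℝ) (hp₂ : 0 < p₂)
    (x y : ℝ) (hx : 0 < x) (hy : 0 < y) :
    (∫ t in (0:ℝ)..((x ^ p₂ + y ^ p₂) / 2) ^ (1 / p₂), (1 + t ^ q) ^ (-(1 / p))) ≥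
      Real.sqrt ((∫ t in (0:ℝ)..x, (1 + t ^ q) ^ (-(1 / p))) *
        (∫ t in (0:ℝ)..y, (1 + t ^ q) ^ (-(1 / p)))) := by
  wlog hxy : x ≤ y generalizing x y
  · rw [add_comm (x ^ p₂), mul_comm (∫ t in (0:ℝ)..x, _)]
    exact this y x hy hx (le_of_not_ge hxy)
  have hq0 : 0 ≤ q := by linarith
  have hr : -(1 / p) ≤ 0 := by
    have : 0 < p := by linarith
    simpa using this.le
  have hf := continuousOn_one_add_rpow_rpow hq0 (-(1 / p))
  have hpos (t : ℝ) (ht : 0 ≤ t) : 0 < (1 + t ^ q) ^ (-(1 / p)) := by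
    have := Real.rpow_nonneg ht q
    positivity
  have hk : 1 ≤ √(y / x) := by
    rw [Real.one_le_sqrt]
    exact (one_le_div hx).2 hxy
  have hkk : √(y / x) * (√(y / x) * x) = y := by
    rw [← mul_assoc, Real.mul_self_sqrt (by positivity), div_mul_cancel₀ _ hx.ne']
  have hkx0 : 0 ≤ √(y / x) * x := by positivity
  have hkx : √(x * y) = √(y / x) * x := by
    rw [Real.sqrt_eq_iff_mul_self_eq (by positivity) hkx0]
    linear_combination (-x) * hkk
  have hmean : √(y / x) * x ≤ ((x ^ p₂ + y ^ p₂) / 2) ^ (1 / p₂) :=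
    hkx ▸ sqrt_mul_le_holder_mean hp₂ hx.le hy.le
  have hsq := integral_mul_integral_le_sq hf hpos hk hx.le
    fun t s ht hts => one_add_rpow_rpow_cross_le hq0 hr hk ht hts
  rw [hkk] at hsq
  calc √_ ≤ ∫ t in (0:ℝ)..(√(y / x) * x), (1 + t ^ q) ^ (-(1 / p)) :=
        Real.sqrt_le_iff.2
          ⟨intervalIntegral.integral_nonneg hkx0 fun t ht => (hpos t ht.1).le, hsq⟩
    _ ≤ _ := by
        rw [← sub_nonneg, intervalIntegral.integral_interval_sub_left
          (intervalIntegrable_of_continuousOn_Ici hf le_rfl (hkx0.trans hmean))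
          (intervalIntegrable_of_continuousOn_Ici hf le_rfl hkx0)]
        exact intervalIntegral.integral_nonneg hmean fun t ht => (hpos t (hkx0.trans ht.1)).le
end

section
/- Let p, q ∈ (1, ∞) and let p₁ ≤ 0. Then the function F(x) = x^{1 - p₁} / (arcsin_{p,q}(x) · (1 - x^q)^{1/p}) is strictly increasing on (0, 1). -/
open MeasureTheory Set

lemma one_sub_mul_rpow_pos {q X s : ℝ} (hq : 0 < q) (hX0 : 0 ≤ X) (hX1 : X < 1)
    (hs : s ∈ Icc (0:ℝ) 1) : 0 < 1 - X * s ^ q := by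
  nlinarith [Real.rpow_le_one hs.1 hs.2 hq.le]

/-- Rescaling the defining integral of `arcsin_{p,q}` to the unit interval. -/
lemma integral_mul_rpow_eq_mul_integral (q c x : ℝ) (hx0 : 0 ≤ x) (hx1 : x ^ q < 1)
    (hq : 0 < q) :
    (∫ t in (0:ℝ)..x, (1 - t ^ q) ^ (-c)) * (1 - x ^ q) ^ c =
      x * ∫ s in (0:ℝ)..1, ((1 - x ^ q) / (1 - x ^ q * s ^ q)) ^ c := by
  have h := intervalIntegral.mul_integral_comp_mul_left (a := 0) (b := 1)
    (f := fun t : ℝ => (1 - t ^ q) ^ (-c)) (c := x)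
  simp only [mul_zero, mul_one] at h
  rw [← h, mul_assoc, ← intervalIntegral.integral_mul_const]
  congr 1
  refine intervalIntegral.integral_congr fun s hs => ?_
  rw [uIcc_of_le zero_le_one] at hs
  have hden := one_sub_mul_rpow_pos hq (Real.rpow_nonneg hx0 q) hx1 hs
  rw [Real.mul_rpow hx0 hs.1, Real.div_rpow (by linarith) hden.le, Real.rpow_neg hden.le]
  ring

lemma continuousOn_one_sub_div_rpow {q c X : ℝ} (hq : 0 < q) (hc : 0 < c) (hX0 : 0 ≤ X)
    (hX1 : X < 1) :
    ContinuousOn (fun s : ℝ => ((1 - X) / (1 - X * s ^ q)) ^ c) (Icc 0 1) := by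
  refine ContinuousOn.rpow_const ?_ fun _ _ => Or.inr hc.le
  refine continuousOn_const.div ?_ fun s hs => (one_sub_mul_rpow_pos hq hX0 hX1 hs).ne'
  exact continuousOn_const.sub (continuousOn_const.mul
    (Real.continuous_rpow_const hq.le).continuousOn)

lemma integral_one_sub_div_rpow_pos {q c X : ℝ} (hq : 0 < q) (hc : 0 < c) (hX0 : 0 ≤ X)
    (hX1 : X < 1) :
    0 < ∫ s in (0:ℝ)..1, ((1 - X) / (1 - X * s ^ q)) ^ c := by
  refine intervalIntegral.intervalIntegral_pos_of_pos_on ?_ (fun s hs => ?_) zero_lt_one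
  · exact (continuousOn_one_sub_div_rpow hq hc hX0 hX1).intervalIntegrable_of_Icc zero_le_one
  · exact Real.rpow_pos_of_pos
      (div_pos (by linarith) (one_sub_mul_rpow_pos hq hX0 hX1 ⟨hs.1.le, hs.2.le⟩)) c

lemma integral_one_sub_div_rpow_lt {q c X Y : ℝ} (hq : 0 < q) (hc : 0 < c) (hX0 : 0 ≤ X)
    (hXY : X < Y) (hY1 : Y < 1) :
    ∫ s in (0:ℝ)..1, ((1 - Y) / (1 - Y * s ^ q)) ^ c <
      ∫ s in (0:ℝ)..1, ((1 - X) / (1 - X * s ^ q)) ^ c := by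
  have hY0 : 0 ≤ Y := hX0.trans hXY.le
  have hX1 : X < 1 := hXY.trans hY1
  refine intervalIntegral.integral_lt_integral_of_continuousOn_of_le_of_exists_lt zero_lt_one
    (continuousOn_one_sub_div_rpow hq hc hY0 hY1) (continuousOn_one_sub_div_rpow hq hc hX0 hX1)
    (fun s hs => ?_) ⟨0, by simp, ?_⟩
  · have hs' := Ioc_subset_Icc_self hs
    have hdX := one_sub_mul_rpow_pos hq hX0 hX1 hs'
    have hdY := one_sub_mul_rpow_pos hq hY0 hY1 hs'
    refine Real.rpow_le_rpow (div_nonneg (by linarith) hdY.le) ?_ hc.le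
    rw [div_le_div_iff₀ hdY hdX]
    nlinarith [mul_nonneg (sub_nonneg.2 hXY.le)
      (sub_nonneg.2 (Real.rpow_le_one hs'.1 hs'.2 hq.le))]
  · simp only [Real.zero_rpow hq.ne', mul_zero, sub_zero, div_one]
    exact Real.rpow_lt_rpow (by linarith) (by linarith) hc

/-- For `p, q ∈ (1, ∞)` and `p₁ ≤ 0`, the function
`F(x) = x^(1-p₁) / (arcsin_{p,q}(x) · (1 - x^q)^(1/p))` is strictly increasing
on `(0, 1)`, where `arcsin_{p,q}(x) = ∫₀ˣ (1 - t^q)^(-1/p) dt`. -/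
theorem F_strictMonoOn (p q : ℝ) (hp : 1 < p) (hq : 1 < q) (p₁ : ℝ) (hp₁ : p₁ ≤ 0) :
    StrictMonoOn
      (fun x : ℝ => x ^ (1 - p₁) /
        ((∫ t in (0:ℝ)..x, (1 - t ^ q) ^ (-(1 / p))) * (1 - x ^ q) ^ (1 / p)))
      (Set.Ioo (0 : ℝ) 1) := by
  have hq0 : 0 < q := by linarith
  have hc : 0 < 1 / p := by positivity
  rintro x ⟨hx0, hx1⟩ y ⟨hy0, hy1⟩ hxy
  have hX0 : 0 ≤ x ^ q := Real.rpow_nonneg hx0.le q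
  have hY0 : 0 ≤ y ^ q := Real.rpow_nonneg hy0.le q
  have hX1 : x ^ q < 1 := Real.rpow_lt_one hx0.le hx1 hq0
  have hY1 : y ^ q < 1 := Real.rpow_lt_one hy0.le hy1 hq0
  have hXY : x ^ q < y ^ q := Real.rpow_lt_rpow hx0.le hxy hq0
  simp only
  rw [integral_mul_rpow_eq_mul_integral q (1 / p) x hx0.le hX1 hq0,
    integral_mul_rpow_eq_mul_integral q (1 / p) y hy0.le hY1 hq0,
    sub_eq_add_neg, Real.rpow_add hx0, Real.rpow_add hy0, Real.rpow_one, Real.rpow_one,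
    mul_div_mul_left _ _ hx0.ne', mul_div_mul_left _ _ hy0.ne']
  exact div_lt_div₀' (Real.rpow_le_rpow hx0.le hxy.le (by linarith))
    (integral_one_sub_div_rpow_lt hq0 hc hX0 hXY hY1) (Real.rpow_pos_of_pos hy0 _)
    (integral_one_sub_div_rpow_pos hq0 hc hY0 hY1)
end

section
/- Let p, q ∈ (1, ∞). Then the function G(x) = q·x^q / (p·(1 - x^q)) − x / (arcsin_{p,q}(x) · (1 - x^q)^{1/p}) maps the interval (0, 1) onto the interval (−1, ∞); in particular G(x) > −1 for all x ∈ (0, 1), and every value in (−1, ∞) is attained. -/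
open MeasureTheory Set

open Filter Topology

lemma one_sub_rpow_pos {q t : ℝ} (hq : 0 < q) (ht0 : 0 ≤ t) (ht1 : t < 1) : 0 < 1 - t ^ q :=
  sub_pos.2 (Real.rpow_lt_one ht0 ht1 hq)

/-- The integrand of the generalized inverse sine. -/
noncomputable def arcsinKernel (p q t : ℝ) : ℝ := (1 - t ^ q) ^ (-(1 / p))

/-- The logarithmic derivative `t h'(t) / h(t)` of `h = arcsinKernel p q`. -/
noncomputable def kernelLogDeriv (p q t : ℝ) : ℝ := q * t ^ q / (p * (1 - t ^ q))

section

variable {p q : ℝ}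

lemma continuousAt_arcsinKernel (hq : 0 < q) {t : ℝ} (ht0 : 0 ≤ t) (ht1 : t < 1) :
    ContinuousAt (arcsinKernel p q) t :=
  (continuousAt_const.sub (Real.continuousAt_rpow_const t q (Or.inr hq.le))).rpow_const
    (Or.inl (one_sub_rpow_pos hq ht0 ht1).ne')

lemma continuousAt_kernelLogDeriv (hp : 0 < p) (hq : 0 < q) {t : ℝ} (ht0 : 0 ≤ t) (ht1 : t < 1) :
    ContinuousAt (kernelLogDeriv p q) t := by
  have h := Real.continuousAt_rpow_const t q (Or.inr hq.le)
  exact (continuousAt_const.mul h).div (continuousAt_const.mul (continuousAt_const.sub h))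
    (mul_pos hp (one_sub_rpow_pos hq ht0 ht1)).ne'

lemma arcsinKernel_pos (hq : 0 < q) {t : ℝ} (ht0 : 0 ≤ t) (ht1 : t < 1) :
    0 < arcsinKernel p q t :=
  Real.rpow_pos_of_pos (one_sub_rpow_pos hq ht0 ht1) _

lemma arcsinKernel_le (hp : 0 < p) (hq : 0 < q) {s t : ℝ} (hs : 0 ≤ s) (hst : s ≤ t)
    (ht1 : t < 1) : arcsinKernel p q s ≤ arcsinKernel p q t :=
  Real.rpow_le_rpow_of_nonpos (one_sub_rpow_pos hq (hs.trans hst) ht1)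
    (sub_le_sub_left (Real.rpow_le_rpow hs hst hq.le) _) (by simpa using hp.le)

lemma arcsinKernel_zero (hq : 0 < q) : arcsinKernel p q 0 = 1 := by
  simp [arcsinKernel, Real.zero_rpow hq.ne']

lemma kernelLogDeriv_zero (hq : 0 < q) : kernelLogDeriv p q 0 = 0 := by
  simp [kernelLogDeriv, Real.zero_rpow hq.ne']

lemma kernelLogDeriv_lt (hp : 0 < p) (hq : 0 < q) {s t : ℝ} (hs : 0 ≤ s) (hst : s < t)
    (ht1 : t < 1) : kernelLogDeriv p q s < kernelLogDeriv p q t := by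
  have h1 := Real.rpow_lt_rpow hs hst hq
  have h2 := one_sub_rpow_pos hq (hs.trans hst.le) ht1
  have h3 := one_sub_rpow_pos hq hs (hst.trans ht1)
  unfold kernelLogDeriv
  rw [div_lt_div_iff₀ (mul_pos hp h3) (mul_pos hp h2)]
  nlinarith [mul_pos (mul_pos hp hq) (sub_pos.2 h1)]

lemma hasDerivAt_mul_arcsinKernel (hp : 0 < p) (hq : 1 < q) {t : ℝ} (ht0 : 0 ≤ t) (ht1 : t < 1) :
    HasDerivAt (fun t => t * arcsinKernel p q t)
      (arcsinKernel p q t * (1 + kernelLogDeriv p q t)) t := by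
  have hpos := one_sub_rpow_pos (zero_lt_one.trans hq) ht0 ht1
  have h1 := ((Real.hasDerivAt_rpow_const (x := t) (p := q) (Or.inr hq.le)).const_sub
    1).rpow_const (p := -(1 / p)) (Or.inl hpos.ne')
  refine ((hasDerivAt_id t).mul h1).congr_deriv ?_
  have h2 : t * t ^ (q - 1) = t ^ q := by
    rw [← Real.rpow_one_add' ht0 (by linarith)]; ring_nf
  unfold arcsinKernel kernelLogDeriv
  rw [Real.rpow_sub_one hpos.ne', ← h2]
  rw [← h2] at hpos
  have := hpos.ne'
  simp only [id]
  field_simp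

lemma continuousOn_arcsinKernel (hq : 0 < q) {x : ℝ} (hx1 : x < 1) :
    ContinuousOn (arcsinKernel p q) (Icc 0 x) := fun _ ht =>
  (continuousAt_arcsinKernel hq ht.1 (ht.2.trans_lt hx1)).continuousWithinAt

lemma intervalIntegrable_arcsinKernel (hq : 0 < q) {x : ℝ} (hx0 : 0 ≤ x) (hx1 : x < 1) :
    IntervalIntegrable (arcsinKernel p q) volume 0 x :=
  (continuousOn_arcsinKernel hq hx1).intervalIntegrable_of_Icc hx0

lemma le_integral_arcsinKernel (hp : 0 < p) (hq : 0 < q) {x : ℝ} (hx0 : 0 ≤ x) (hx1 : x < 1) :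
    x ≤ ∫ t in (0:ℝ)..x, arcsinKernel p q t := by
  have := intervalIntegral.integral_mono_on hx0 intervalIntegrable_const
    (intervalIntegrable_arcsinKernel (p := p) hq hx0 hx1)
    (f := fun _ => (1 : ℝ)) fun t ht => by
      simpa [arcsinKernel_zero hq] using
        arcsinKernel_le hp hq le_rfl ht.1 (ht.2.trans_lt hx1)
  simpa using this

lemma integral_arcsinKernel_le (hp : 0 < p) (hq : 0 < q) {x : ℝ} (hx0 : 0 ≤ x) (hx1 : x < 1) :
    ∫ t in (0:ℝ)..x, arcsinKernel p q t ≤ x * arcsinKernel p q x := by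
  have := intervalIntegral.integral_mono_on hx0
    (intervalIntegrable_arcsinKernel (p := p) hq hx0 hx1) intervalIntegrable_const
    (g := fun _ => arcsinKernel p q x) fun t ht => arcsinKernel_le hp hq ht.1 ht.2 hx1
  simpa using this

lemma mul_arcsinKernel_lt (hp : 0 < p) (hq : 1 < q) {x : ℝ} (hx0 : 0 < x) (hx1 : x < 1) :
    x * arcsinKernel p q x <
      (∫ t in (0:ℝ)..x, arcsinKernel p q t) * (1 + kernelLogDeriv p q x) := by
  have hq0 := zero_lt_one.trans hq
  have hc := continuousOn_arcsinKernel (p := p) hq0 hx1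
  have hr : ContinuousOn (kernelLogDeriv p q) (Icc 0 x) := fun t ht =>
    (continuousAt_kernelLogDeriv hp hq0 ht.1 (ht.2.trans_lt hx1)).continuousWithinAt
  have hd := hc.mul (continuousOn_const (c := (1 : ℝ)).add hr)
  have hftc := intervalIntegral.integral_eq_sub_of_hasDerivAt (a := 0) (b := x)
    (f := fun t => t * arcsinKernel p q t)
    (f' := fun t => arcsinKernel p q t * (1 + kernelLogDeriv p q t))
    (fun t ht => by
      rw [uIcc_of_le hx0.le] at ht
      exact hasDerivAt_mul_arcsinKernel hp hq ht.1 (ht.2.trans_lt hx1))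
    (hd.intervalIntegrable_of_Icc hx0.le)
  simp only [zero_mul, sub_zero] at hftc
  rw [← hftc, ← intervalIntegral.integral_mul_const]
  refine intervalIntegral.integral_lt_integral_of_continuousOn_of_le_of_exists_lt hx0 hd
    (hc.mul continuousOn_const) (fun t ht => ?_) ⟨0, ⟨le_rfl, hx0.le⟩, ?_⟩
  · refine mul_le_mul_of_nonneg_left ?_ (arcsinKernel_pos hq0 ht.1.le (ht.2.trans_lt hx1)).le
    rcases ht.2.eq_or_lt with rfl | h
    · rfl
    · linarith [kernelLogDeriv_lt hp hq0 ht.1.le h hx1]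
  · refine mul_lt_mul_of_pos_left ?_ (arcsinKernel_pos hq0 le_rfl one_pos)
    linarith [kernelLogDeriv_lt hp hq0 le_rfl hx0 hx1]

lemma continuousAt_integral_arcsinKernel (hq : 0 < q) {x : ℝ} (hx0 : 0 ≤ x) (hx1 : x < 1) :
    ContinuousAt (fun y => ∫ t in (0:ℝ)..y, arcsinKernel p q t) x := by
  have hm : Measurable (arcsinKernel p q) := by unfold arcsinKernel; fun_prop
  exact (intervalIntegral.integral_hasDerivAt_right
    (intervalIntegrable_arcsinKernel hq hx0 hx1)
    hm.stronglyMeasurable.stronglyMeasurableAtFilter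
    (continuousAt_arcsinKernel hq hx0 hx1)).continuousAt

lemma exists_le_kernelLogDeriv_sub (hp : 1 < p) (hq : 0 < q) (y : ℝ) :
    ∃ x ∈ Ioo (0 : ℝ) 1, y ≤ kernelLogDeriv p q x - arcsinKernel p q x := by
  have hp0 := zero_lt_one.trans hp
  have hexp : 0 < 1 - 1 / p := sub_pos.2 ((div_lt_one hp0).2 hp)
  have hlim : Tendsto (fun s : ℝ => q / p * (1 - s) - s ^ (1 - 1 / p)) (𝓝[>] 0) (𝓝 (q / p)) := by
    have : ContinuousAt (fun s : ℝ => q / p * (1 - s) - s ^ (1 - 1 / p)) 0 :=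
      (by fun_prop : ContinuousAt (fun s : ℝ => q / p * (1 - s)) 0).sub
        (Real.continuousAt_rpow_const _ _ (Or.inr hexp.le))
    have h := this.tendsto.mono_left (nhdsWithin_le_nhds (s := Ioi 0))
    simpa only [Real.zero_rpow hexp.ne', sub_zero, mul_one] using h
  have htop := tendsto_inv_nhdsGT_zero.atTop_mul_pos (div_pos hq hp0) hlim
  obtain ⟨s, hy, hs⟩ := ((htop.eventually_ge_atTop y).and
    (Ioo_mem_nhdsGT (zero_lt_one' ℝ))).exists
  have hs0 : 0 < 1 - s := sub_pos.2 hs.2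
  refine ⟨(1 - s) ^ q⁻¹, ⟨Real.rpow_pos_of_pos hs0 _,
    Real.rpow_lt_one hs0.le (by linarith [hs.1]) (inv_pos.2 hq)⟩, hy.trans_eq ?_⟩
  have hs1 := hs.1.ne'
  rw [kernelLogDeriv, arcsinKernel, Real.rpow_inv_rpow hs0.le hq.ne', sub_sub_cancel,
    sub_eq_add_neg (1 : ℝ) (1 / p), Real.rpow_add hs.1, Real.rpow_one]
  field_simp

lemma exists_kernelLogDeriv_le (hp : 0 < p) (hq : 0 < q) {ε : ℝ} (hε : 0 < ε) :
    ∃ x ∈ Ioo (0 : ℝ) 1, kernelLogDeriv p q x ≤ ε := by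
  have h := (continuousAt_kernelLogDeriv hp hq le_rfl one_pos).tendsto.mono_left
    (nhdsWithin_le_nhds (s := Ioi (0 : ℝ)))
  rw [kernelLogDeriv_zero hq] at h
  obtain ⟨x, hx, hx'⟩ := ((h.eventually_le_const hε).and
    (Ioo_mem_nhdsGT (zero_lt_one' ℝ))).exists
  exact ⟨x, hx', hx⟩

end

/-- For `p, q ∈ (1, ∞)`, the function
`G(x) = q x^q / (p (1 - x^q)) − x / (arcsin_{p,q}(x) · (1 - x^q)^(1/p))`
maps `(0, 1)` onto `(-1, ∞)`. -/
theorem G_image (p q : ℝ) (hp : 1 < p) (hq : 1 < q) :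
    (fun x : ℝ => q * x ^ q / (p * (1 - x ^ q)) -
        x / ((∫ t in (0:ℝ)..x, (1 - t ^ q) ^ (-(1 / p))) * (1 - x ^ q) ^ (1 / p))) ''
      Set.Ioo (0 : ℝ) 1 = Set.Ioi (-1 : ℝ) := by
  have hp0 := zero_lt_one.trans hp
  have hq0 := zero_lt_one.trans hq
  have hA : ∀ x ∈ Ioo (0 : ℝ) 1, 0 < ∫ t in (0:ℝ)..x, arcsinKernel p q t := fun x hx =>
    hx.1.trans_le (le_integral_arcsinKernel hp0 hq0 hx.1.le hx.2)
  set G : ℝ → ℝ := fun x => kernelLogDeriv p q x -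
    x * arcsinKernel p q x / ∫ t in (0:ℝ)..x, arcsinKernel p q t with hG
  have hcongr : ∀ x ∈ Ioo (0 : ℝ) 1, q * x ^ q / (p * (1 - x ^ q)) -
      x / ((∫ t in (0:ℝ)..x, (1 - t ^ q) ^ (-(1 / p))) * (1 - x ^ q) ^ (1 / p)) = G x := by
    intro x hx
    simp only [hG, kernelLogDeriv, arcsinKernel]
    rw [Real.rpow_neg (one_sub_rpow_pos hq0 hx.1.le hx.2).le (1 / p), mul_comm (∫ _ in _.._, _),
      ← div_div x, div_eq_mul_inv x]
  rw [image_congr hcongr]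
  have hcont : ContinuousOn G (Ioo 0 1) := fun x hx =>
    ((continuousAt_kernelLogDeriv hp0 hq0 hx.1.le hx.2).sub
      ((continuousAt_id.mul (continuousAt_arcsinKernel hq0 hx.1.le hx.2)).div
        (continuousAt_integral_arcsinKernel hq0 hx.1.le hx.2)
        (hA x hx).ne')).continuousWithinAt
  apply Subset.antisymm
  · rintro _ ⟨x, hx, rfl⟩
    have h := mul_arcsinKernel_lt hp0 hq hx.1 hx.2
    rw [mul_comm (∫ _ in _.._, _), ← div_lt_iff₀ (hA x hx)] at h
    simp only [hG, mem_Ioi]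
    linarith
  · intro y hy
    obtain ⟨a, ha, hay⟩ := exists_kernelLogDeriv_le hp0 hq0
      (show 0 < y + 1 by linarith [mem_Ioi.1 hy])
    obtain ⟨b, hb, hyb⟩ := exists_le_kernelLogDeriv_sub hp hq0 y
    refine isPreconnected_Ioo.intermediate_value ha hb hcont ⟨?_, ?_⟩
    · have := (one_le_div (hA a ha)).2 (integral_arcsinKernel_le hp0 hq0 ha.1.le ha.2)
      simp only [hG]
      linarith
    · have : b * arcsinKernel p q b / (∫ t in (0:ℝ)..b, arcsinKernel p q t) ≤
          arcsinKernel p q b := by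
        rw [div_le_iff₀ (hA b hb), mul_comm]
        exact mul_le_mul_of_nonneg_left (le_integral_arcsinKernel hp0 hq0 hb.1.le hb.2)
          (arcsinKernel_pos hq0 hb.1.le hb.2).le
      simp only [hG]
      linarith
end
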